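/- The λ-open topology τ_λ makes (C(X,ℝ^ι),+) a Hausdorff topological group (jointly continuous addition, continuous negation, Hausdorff topology) if and only if λ is a π-network of X consisting of C_ι-compact subsets of X and λ = λ(C_ι). -/

import Mathlib

open Topology Set

/-- The λ-open (set-open) topology on `C(X, ι → ℝ)` generated by the subbasis
`[A, U] = {f | f(A) ⊆ U}` for `A ∈ Λ` and `U` open in `ι → ℝ`. -/
def setOpenTopology {X : Type*} [TopologicalSpace X] (ι : Type*) (Λ : Set (Set X)) :
    TopologicalSpace C(X, ι → ℝ) :=
  TopologicalSpace.generateFrom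
    {S | ∃ A ∈ Λ, ∃ U : Set (ι → ℝ), IsOpen U ∧ S = {f : C(X, ι → ℝ) | Set.MapsTo f A U}}

/-- A subset `B ⊆ X` is `C_ι`-compact in `X` if `f(B)` is compact in `ℝ^ι`
for every continuous `f : X → ℝ^ι`. -/
def CCompactIn {X : Type*} [TopologicalSpace X] (ι : Type*) (B : Set X) : Prop :=
  ∀ f : C(X, ι → ℝ), IsCompact (⇑f '' B)

/-- The family `λ(C_ι)`. -/
def lambdaC {X : Type*} [TopologicalSpace X] (ι : Type*) (Λ : Set (Set X)) : Set (Set X) :=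
  {A | A ∈ Λ ∧ ∀ B ⊆ A, CCompactIn ι B → ∀ U : Set (ι → ℝ), IsOpen U →
    IsOpen[setOpenTopology ι Λ] {f : C(X, ι → ℝ) | Set.MapsTo f B U}}

theorem isOpen_setOf_mapsTo_setOpenTopology {X : Type*} [TopologicalSpace X] {ι : Type*}
    {Λ : Set (Set X)} {A : Set X} (hA : A ∈ Λ) {U : Set (ι → ℝ)} (hU : IsOpen U) :
    IsOpen[setOpenTopology ι Λ] {f : C(X, ι → ℝ) | MapsTo f A U} :=
  TopologicalSpace.isOpen_generateFrom_of_mem ⟨A, hA, U, hU, rfl⟩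

theorem continuous_neg_setOpenTopology {X : Type*} [TopologicalSpace X] (ι : Type*)
    (Λ : Set (Set X)) :
    Continuous[setOpenTopology ι Λ, setOpenTopology ι Λ] (fun f : C(X, ι → ℝ) => -f) := by
  refine continuous_generateFrom_iff.2 ?_
  rintro _ ⟨A, hA, U, hU, rfl⟩
  exact isOpen_setOf_mapsTo_setOpenTopology hA (hU.preimage continuous_neg)

theorem continuous_const_setOpenTopology {X : Type*} [TopologicalSpace X] (ι : Type*)
    {Λ : Set (Set X)} (hΛ : ∀ A ∈ Λ, A.Nonempty) :
    Continuous[inferInstance, setOpenTopology ι Λ]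
      (fun w : ι → ℝ => ContinuousMap.const X w) := by
  refine continuous_generateFrom_iff.2 ?_
  rintro _ ⟨A, hA, U, hU, rfl⟩
  obtain ⟨a, ha⟩ := hΛ A hA
  convert hU using 1
  ext w
  exact ⟨fun h => h ha, fun h _ _ => h⟩

theorem t2Space_setOpenTopology {X : Type*} [TopologicalSpace X] (ι : Type*)
    {Λ : Set (Set X)} (hΛ : ∀ A ∈ Λ, A.Nonempty)
    (hπ : ∀ U : Set X, IsOpen U → U.Nonempty → ∃ A ∈ Λ, A ⊆ U) :
    @T2Space C(X, ι → ℝ) (setOpenTopology ι Λ) := by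
  refine @T2Space.mk _ (setOpenTopology ι Λ) fun f g hfg => ?_
  obtain ⟨x, hx⟩ := DFunLike.ne_iff.1 hfg
  obtain ⟨U, V, hU, hV, hfU, hgV, hUV⟩ := t2_separation hx
  obtain ⟨A, hA, hAUV⟩ := hπ (f ⁻¹' U ∩ g ⁻¹' V)
    ((hU.preimage f.continuous).inter (hV.preimage g.continuous)) ⟨x, hfU, hgV⟩
  refine ⟨_, _, isOpen_setOf_mapsTo_setOpenTopology hA hU,
    isOpen_setOf_mapsTo_setOpenTopology hA hV,
    fun a ha => (hAUV ha).1, fun a ha => (hAUV ha).2, ?_⟩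
  obtain ⟨a, ha⟩ := hΛ A hA
  exact disjoint_left.2 fun k hkU hkV => disjoint_left.1 hUV (hkU ha) (hkV ha)

theorem exists_mem_subset_of_t2Space_setOpenTopology {X : Type*} [TopologicalSpace X]
    [CompletelyRegularSpace X] {ι : Type*} [Nonempty ι] {Λ : Set (Set X)}
    (h : @T2Space C(X, ι → ℝ) (setOpenTopology ι Λ))
    {U : Set X} (hU : IsOpen U) (hne : U.Nonempty) : ∃ A ∈ Λ, A ⊆ U := by
  by_contra! hcon
  obtain ⟨x, hx⟩ := hne
  obtain ⟨φ, hφ, hφx, hφU⟩ := CompletelyRegularSpace.completely_regular x Uᶜ hU.isClosed_compl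
    (not_not_intro hx)
  let f : C(X, ι → ℝ) := ⟨fun y _ => 1 - (φ y : ℝ), by fun_prop⟩
  have hspec : @Specializes _ (setOpenTopology ι Λ) 0 f := by
    refine (@specializes_iff_pure _ (setOpenTopology ι Λ) _ _).2 ?_
    rw [setOpenTopology, TopologicalSpace.nhds_generateFrom]
    refine le_iInf₂ ?_
    rintro _ ⟨hf, A, hA, V, hV, rfl⟩
    obtain ⟨a, ha, haU⟩ := not_subset.1 (hcon A hA)
    have hfa : f a = 0 := by
      funext i
      simp [f, hφU haU]
    refine Filter.le_principal_iff.2 fun b _ => ?_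
    have := hf ha
    rwa [hfa] at this
  have h0 : (0 : C(X, ι → ℝ)) = f := @Specializes.eq _ (setOpenTopology ι Λ) _ _ _ hspec
  obtain ⟨i⟩ := ‹Nonempty ι›
  have := congrFun (DFunLike.congr_fun h0 x) i
  simp [f, hφx] at this

theorem CCompactIn.of_isClosed_image {X : Type*} [TopologicalSpace X] {ι : Type*} [Nonempty ι]
    {A : Set X} (h : ∀ f : C(X, ι → ℝ), IsClosed (f '' A)) : CCompactIn ι A := by
  have bdd (φ : C(X, ℝ)) : ∃ M, ∀ a ∈ A, |φ a| ≤ M := by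
    by_contra! hφ
    have hpos (y : X) : 0 < 1 + |φ y| := by positivity
    let g : C(X, ι → ℝ) := ⟨fun y _ => (1 + |φ y|)⁻¹,
      continuous_pi fun _ => Continuous.inv₀ (by fun_prop) fun y => (hpos y).ne'⟩
    choose a haA ha using fun n : ℕ => hφ n
    have hlim : Filter.Tendsto (fun n => g (a n)) Filter.atTop (𝓝 0) := by
      refine tendsto_pi_nhds.2 fun _ => ?_
      refine Filter.Tendsto.inv_tendsto_atTop ?_
      refine Filter.tendsto_atTop_mono (fun n => ?_) tendsto_natCast_atTop_atTop
      linarith [ha n]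
    obtain ⟨b, -, hb⟩ := (h g).mem_of_tendsto hlim
      (Filter.Eventually.of_forall fun n => mem_image_of_mem g (haA n))
    obtain ⟨i⟩ := ‹Nonempty ι›
    exact (inv_pos.2 (hpos b)).ne' (congrFun hb i)
  intro f
  choose M hM using fun i => bdd ⟨fun x => f x i, by fun_prop⟩
  refine (isCompact_univ_pi fun i => isCompact_Icc (a := -M i) (b := M i)).of_isClosed_subset
    (h f) ?_
  rintro _ ⟨a, ha, rfl⟩ i -
  exact abs_le.1 (hM i a ha)

/-- The intersection of a `C_ι`-compact set with a zero set is `C_ι`-compact. -/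
theorem CCompactIn.inter_preimage_zero {X : Type*} [TopologicalSpace X] {ι : Type*} [Nonempty ι]
    {A : Set X} (hA : CCompactIn ι A) (φ : C(X, ℝ)) : CCompactIn ι (A ∩ φ ⁻¹' {0}) := by
  intro g
  refine (hA g).of_isClosed_subset ?_ (image_mono inter_subset_left)
  refine isClosed_of_closure_subset fun p hp => ?_
  let h : C(X, ι → ℝ) := ⟨fun x i => |g x i - p i| + |φ x|, by fun_prop⟩
  have h0 : (0 : ι → ℝ) ∈ closure (h '' A) := by
    have hcont : Continuous fun (y : ι → ℝ) i => |y i - p i| := by fun_prop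
    have := map_mem_closure hcont hp (t := h '' A) ?_
    · convert this using 1
      ext i
      simp
    · rintro _ ⟨a, ⟨haA, haφ⟩, rfl⟩
      refine ⟨a, haA, ?_⟩
      ext i
      simp [h, show φ a = 0 from haφ]
  rw [(hA h).isClosed.closure_eq] at h0
  obtain ⟨a, haA, ha⟩ := h0
  have hi (i : ι) : |g a i - p i| + |φ a| = 0 := congrFun ha i
  have hg (i : ι) : g a i = p i := by
    have := abs_nonneg (φ a)
    have := abs_nonneg (g a i - p i)
    exact sub_eq_zero.1 (abs_eq_zero.1 (by linarith [hi i]))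
  refine ⟨a, ⟨haA, ?_⟩, funext hg⟩
  obtain ⟨i⟩ := ‹Nonempty ι›
  simpa [hg i] using hi i

theorem setOf_forall_sub_mem_mem_nhds_setOpenTopology {X : Type*} [TopologicalSpace X] {ι : Type*}
    [Nonempty ι] {Λ : Set (Set X)} {A : Set X} (hA : CCompactIn ι A)
    (hopen : ∀ B ⊆ A, CCompactIn ι B → ∀ U : Set (ι → ℝ), IsOpen U →
      IsOpen[setOpenTopology ι Λ] {f : C(X, ι → ℝ) | MapsTo f B U})
    (f : C(X, ι → ℝ)) {V : Set (ι → ℝ)} (hV : V ∈ 𝓝 0) :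
    {g : C(X, ι → ℝ) | ∀ x ∈ A, g x - f x ∈ V} ∈ @nhds _ (setOpenTopology ι Λ) f := by
  let _ := setOpenTopology (X := X) ι Λ
  obtain ⟨W, hWo, hW0, hWV⟩ : ∃ W : Set (ι → ℝ), IsOpen W ∧ 0 ∈ W ∧
      ∀ v ∈ W, ∀ w ∈ W, v - w ∈ V := by
    obtain ⟨W, hW, hWV⟩ := exists_nhds_half_neg hV
    exact ⟨interior W, isOpen_interior, mem_interior_iff_mem_nhds.2 hW,
      fun v hv w hw => hWV v (interior_subset hv) w (interior_subset hw)⟩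
  have hT (y : ι → ℝ) : IsOpen ((fun z => z - y) ⁻¹' W) := hWo.preimage (by fun_prop)
  have hψ (y : ι → ℝ) : ∃ ψ : C(ι → ℝ, ℝ), (∀ᶠ z in 𝓝 y, ψ z = 0) ∧
      ∀ z, ψ z = 0 → z - y ∈ W := by
    obtain ⟨φ, hφ, hφy, hφW⟩ := CompletelyRegularSpace.completely_regular y
      ((fun z => z - y) ⁻¹' W)ᶜ (hT y).isClosed_compl (by simpa using hW0)
    refine ⟨⟨fun z => max ((φ z : ℝ) - 1 / 2) 0, by fun_prop⟩, ?_, fun z hz => ?_⟩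
    · have hlt : ∀ᶠ z in 𝓝 y, (φ z : ℝ) < 1 / 2 :=
        (continuous_subtype_val.comp hφ).continuousAt.eventually_lt continuousAt_const
          (by simp [hφy])
      filter_upwards [hlt] with z hz
      exact max_eq_right (by linarith)
    · by_contra hzW
      have h1 : φ z = 1 := hφW hzW
      have : max ((φ z : ℝ) - 1 / 2) 0 = 0 := hz
      norm_num [h1] at this
  choose ψ hψn hψW using hψ
  obtain ⟨s, -, hs⟩ := (hA f).elim_nhds_subcover (fun y => {z | ψ y z = 0}) fun y _ => hψn y
  have hev : ∀ y ∈ s, ∀ᶠ g : C(X, ι → ℝ) in 𝓝 f,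
      MapsTo g (A ∩ (ψ y).comp f ⁻¹' {0}) ((fun z => z - y) ⁻¹' W) := fun y _ =>
    (hopen _ inter_subset_left (hA.inter_preimage_zero _) _ (hT y)).mem_nhds
      fun x hx => hψW y _ hx.2
  filter_upwards [(Filter.eventually_all_finset s).2 hev] with g hg x hx
  obtain ⟨y, hys, hy⟩ := mem_iUnion₂.1 (hs (mem_image_of_mem f hx))
  simpa using hWV _ (hg y hys ⟨hx, hy⟩) _ (hψW y _ hy)

theorem continuous_add_setOpenTopology {X : Type*} [TopologicalSpace X] {ι : Type*}
    [Nonempty ι] {Λ : Set (Set X)} (hC : ∀ A ∈ Λ, CCompactIn ι A) (hΛC : Λ = lambdaC ι Λ) :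
    Continuous[@instTopologicalSpaceProd _ _ (setOpenTopology ι Λ) (setOpenTopology ι Λ),
        setOpenTopology ι Λ]
      (fun p : C(X, ι → ℝ) × C(X, ι → ℝ) => p.1 + p.2) := by
  let _ := setOpenTopology (X := X) ι Λ
  refine continuous_generateFrom_iff.2 ?_
  rintro _ ⟨A, hA, U, hU, rfl⟩
  refine isOpen_iff_mem_nhds.2 ?_
  rintro ⟨f, g⟩ hfg
  obtain ⟨V, hV, hVU⟩ := compact_open_separated_add_right (hC A hA (f + g)) hU hfg.image_subset
  obtain ⟨W, hW, hWV⟩ := exists_nhds_zero_half hV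
  have hopen := (hΛC ▸ hA : A ∈ lambdaC ι Λ).2
  rw [nhds_prod_eq]
  filter_upwards [Filter.prod_mem_prod
    (setOf_forall_sub_mem_mem_nhds_setOpenTopology (hC A hA) hopen f hW)
    (setOf_forall_sub_mem_mem_nhds_setOpenTopology (hC A hA) hopen g hW)]
  rintro ⟨f', g'⟩ ⟨hf', hg'⟩ x hx
  convert hVU (Set.add_mem_add (mem_image_of_mem _ hx) (hWV _ (hf' x hx) _ (hg' x hx))) using 1
  simp only [ContinuousMap.add_apply]
  abel

theorem CCompactIn.of_continuous_add_left {X : Type*} [TopologicalSpace X] {ι : Type*}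
    [Nonempty ι] {Λ : Set (Set X)} (hΛ : ∀ A ∈ Λ, A.Nonempty)
    (hadd : ∀ f : C(X, ι → ℝ),
      Continuous[setOpenTopology ι Λ, setOpenTopology ι Λ] (fun g => f + g))
    {A : Set X} (hA : A ∈ Λ) : CCompactIn ι A := by
  refine CCompactIn.of_isClosed_image fun f => ?_
  let _ := setOpenTopology (X := X) ι Λ
  have hcont : Continuous fun w : ι → ℝ => f + ContinuousMap.const X (-w) :=
    (hadd f).comp ((continuous_const_setOpenTopology ι hΛ).comp continuous_neg)
  have hopen := (isOpen_setOf_mapsTo_setOpenTopology hA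
    (isOpen_compl_singleton (x := (0 : ι → ℝ)))).preimage hcont
  rw [← isOpen_compl_iff]
  convert hopen using 1
  ext w
  simp [MapsTo, ← sub_eq_add_neg, sub_eq_zero]

theorem isOpen_setOf_mapsTo_of_continuous_add_left {X : Type*} [TopologicalSpace X] {ι : Type*}
    {Λ : Set (Set X)}
    (hadd : ∀ f : C(X, ι → ℝ),
      Continuous[setOpenTopology ι Λ, setOpenTopology ι Λ] (fun g => f + g))
    {A B : Set X} (hA : A ∈ Λ) (hBA : B ⊆ A) (hB : CCompactIn ι B) {U : Set (ι → ℝ)}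
    (hU : IsOpen U) : IsOpen[setOpenTopology ι Λ] {f : C(X, ι → ℝ) | MapsTo f B U} := by
  let _ := setOpenTopology (X := X) ι Λ
  refine isOpen_iff_mem_nhds.2 fun f hf => ?_
  obtain ⟨V, hV, hVU⟩ := compact_open_separated_add_right (hB f) hU hf.image_subset
  have hopen := (isOpen_setOf_mapsTo_setOpenTopology hA
    (isOpen_interior (s := V))).preimage (hadd (-f))
  have hmem : MapsTo (-f + f) A (interior V) := fun x _ => by
    simpa using mem_interior_iff_mem_nhds.2 hV
  filter_upwards [hopen.mem_nhds hmem] with g hg x hx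
  convert hVU (Set.add_mem_add (mem_image_of_mem _ hx) (interior_subset (hg (hBA hx)))) using 1
  simp

theorem statement_12 {X : Type*} [TopologicalSpace X] [T35Space X]
    (ι : Type*) [Nonempty ι] (Λ : Set (Set X)) (hΛ : ∀ A ∈ Λ, A.Nonempty) :
    (Continuous[@instTopologicalSpaceProd _ _ (setOpenTopology ι Λ) (setOpenTopology ι Λ),
        setOpenTopology ι Λ]
        (fun p : C(X, ι → ℝ) × C(X, ι → ℝ) => p.1 + p.2) ∧
      Continuous[setOpenTopology ι Λ, setOpenTopology ι Λ]
        (fun f : C(X, ι → ℝ) => -f) ∧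
      @T2Space C(X, ι → ℝ) (setOpenTopology ι Λ)) ↔
    ((∀ U : Set X, IsOpen U → U.Nonempty → ∃ A ∈ Λ, A ⊆ U) ∧
      (∀ A ∈ Λ, CCompactIn ι A) ∧ Λ = lambdaC ι Λ) := by
  constructor
  · rintro ⟨hadd, -, hT2⟩
    have hleft (f : C(X, ι → ℝ)) :
        Continuous[setOpenTopology ι Λ, setOpenTopology ι Λ] (fun g => f + g) := by
      let _ := setOpenTopology (X := X) ι Λ
      exact hadd.comp (continuous_const.prodMk continuous_id)
    refine ⟨fun U hU hne => exists_mem_subset_of_t2Space_setOpenTopology hT2 hU hne,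
      fun A hA => .of_continuous_add_left hΛ hleft hA, ?_⟩
    exact Subset.antisymm (fun A hA => ⟨hA, fun B hBA hB U hU =>
      isOpen_setOf_mapsTo_of_continuous_add_left hleft hA hBA hB hU⟩) fun A hA => hA.1
  · rintro ⟨hπ, hC, hΛC⟩
    exact ⟨continuous_add_setOpenTopology hC hΛC, continuous_neg_setOpenTopology ι Λ,
      t2Space_setOpenTopology ι hΛ hπ⟩
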